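/- arXiv:2010.05818 — 4 statements merged into one kernel-verified Lean document; each statement's English description precedes it below -/
import Mathlib

section
/- Let X ⊆ ℝⁿ, let X₀ ⊆ X and X₁ ⊆ X, let f : ℝⁿ → ℝⁿ and g : ℝⁿ → (ℝᵐ →ₗ ℝⁿ) be the dynamics of the control-affine system ẋ = f(x) + g(x)u, and let 𝐮 : ℝⁿ → ℝᵐ be a feedback controller. Suppose B : ℝⁿ → ℝ is differentiable and satisfies: (i) B(x) ≤ 0 for all x ∈ X₀; (ii) B(x) > 0 for all x ∈ X₁; (iii) for all x ∈ X, the derivative of B at x applied to the closed-loop vector field satisfies (DB)(x)(f(x) + g(x)(𝐮(x))) ≤ 0. If φ : ℝ → ℝⁿ is differentiable on [0,∞) with φ(0) ∈ X₀, φ(t) ∈ X for all t ≥ 0, and φ'(t) = f(φ(t)) + g(φ(t))(𝐮(φ(t))) for all t ≥ 0, then φ(t) ∉ X₁ for all t ≥ 0. -/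
open Set

/-- Theorem 1 of the paper: a control barrier function certifies that closed-loop
trajectories of the control-affine system `ẋ = f(x) + g(x)u` starting in `X₀` never
reach the unsafe set `X₁`. -/
theorem barrier_safety {n m : ℕ} (X X₀ X₁ : Set (Fin n → ℝ))
    (hX₀ : X₀ ⊆ X) (hX₁ : X₁ ⊆ X)
    (f : (Fin n → ℝ) → (Fin n → ℝ))
    (g : (Fin n → ℝ) → ((Fin m → ℝ) →ₗ[ℝ] (Fin n → ℝ)))
    (ufb : (Fin n → ℝ) → (Fin m → ℝ))
    (B : (Fin n → ℝ) → ℝ) (hB : Differentiable ℝ B)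
    (hB0 : ∀ x ∈ X₀, B x ≤ 0)
    (hB1 : ∀ x ∈ X₁, 0 < B x)
    (hBdec : ∀ x ∈ X, fderiv ℝ B x (f x + g x (ufb x)) ≤ 0)
    (φ : ℝ → (Fin n → ℝ))
    (hφ0 : φ 0 ∈ X₀)
    (hφX : ∀ t ≥ (0:ℝ), φ t ∈ X)
    (hφ : ∀ t ≥ (0:ℝ),
      HasDerivWithinAt φ (f (φ t) + g (φ t) (ufb (φ t))) (Ici 0) t) :
    ∀ t ≥ (0:ℝ), φ t ∉ X₁ := by
  have hderiv : ∀ t ∈ Ici (0:ℝ), HasDerivWithinAt (B ∘ φ)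
      (fderiv ℝ B (φ t) (f (φ t) + g (φ t) (ufb (φ t)))) (Ici 0) t := fun t ht =>
    (hB (φ t)).hasFDerivAt.comp_hasDerivWithinAt t (hφ t ht)
  have hanti : AntitoneOn (B ∘ φ) (Ici 0) :=
    antitoneOn_of_hasDerivWithinAt_nonpos (convex_Ici 0)
      (fun t ht => (hderiv t ht).continuousWithinAt)
      (fun t ht => (hderiv t (interior_subset ht)).mono interior_subset)
      (fun t ht => hBdec (φ t) (hφX t (interior_subset ht)))
  intro t ht hmem
  exact (hB1 _ hmem).not_ge ((hanti self_mem_Ici ht ht).trans (hB0 _ hφ0))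
end

section
/- Let X ⊆ ℝⁿ, let f : ℝⁿ → ℝⁿ, g : ℝⁿ → (ℝᵐ →ₗ ℝⁿ), and 𝐮 : ℝⁿ → ℝᵐ. Suppose B : ℝⁿ → ℝ is differentiable and (DB)(x)(f(x) + g(x)(𝐮(x))) ≤ 0 for all x ∈ X. Then the zero-sublevel set {x ∈ X | B(x) ≤ 0} is forward invariant for the closed-loop system: if φ : ℝ → ℝⁿ is differentiable on [0,∞), takes values in X on [0,∞), satisfies φ'(t) = f(φ(t)) + g(φ(t))(𝐮(φ(t))) for all t ≥ 0, and B(φ(0)) ≤ 0, then B(φ(t)) ≤ 0 for all t ≥ 0. -/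
open Set

/-- Forward invariance of the zero-sublevel set `{x ∈ X | B x ≤ 0}` for the closed-loop
control-affine system: if the barrier decrease condition holds on `X` and a closed-loop
trajectory starts with `B (φ 0) ≤ 0`, then `B (φ t) ≤ 0` for all `t ≥ 0`. -/
theorem barrier_sublevel_forward_invariant {n m : ℕ} (X : Set (Fin n → ℝ))
    (f : (Fin n → ℝ) → (Fin n → ℝ))
    (g : (Fin n → ℝ) → ((Fin m → ℝ) →ₗ[ℝ] (Fin n → ℝ)))
    (ufb : (Fin n → ℝ) → (Fin m → ℝ))
    (B : (Fin n → ℝ) → ℝ) (hB : Differentiable ℝ B)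
    (hBdec : ∀ x ∈ X, fderiv ℝ B x (f x + g x (ufb x)) ≤ 0)
    (φ : ℝ → (Fin n → ℝ))
    (hφX : ∀ t ≥ (0:ℝ), φ t ∈ X)
    (hφ : ∀ t ≥ (0:ℝ),
      HasDerivWithinAt φ (f (φ t) + g (φ t) (ufb (φ t))) (Ici 0) t)
    (hφ0 : B (φ 0) ≤ 0) :
    ∀ t ≥ (0:ℝ), B (φ t) ≤ 0 := by
  have hderiv : ∀ t ∈ Ici (0:ℝ), HasDerivWithinAt (B ∘ φ)
      (fderiv ℝ B (φ t) (f (φ t) + g (φ t) (ufb (φ t)))) (Ici 0) t := fun t ht =>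
    (hB (φ t)).hasFDerivAt.comp_hasDerivWithinAt t (hφ t ht)
  have hanti : AntitoneOn (B ∘ φ) (Ici 0) :=
    antitoneOn_of_hasDerivWithinAt_nonpos (convex_Ici 0)
      (fun t ht => (hderiv t ht).continuousWithinAt)
      (fun t ht => (hderiv t (interior_subset ht)).mono interior_subset)
      (fun t ht => hBdec _ (hφX t (interior_subset ht)))
  exact fun t ht => (hanti self_mem_Ici ht ht).trans hφ0
end

section
/- Let X ⊆ ℝⁿ, X₀ ⊆ X, X₁ ⊆ X, let U ⊆ ℝᵐ, let μ : ℝⁿ → ℝⁿ, g : ℝⁿ → (ℝᵐ →ₗ ℝⁿ), let D ⊆ ℝⁿ, and let 𝐮 : ℝⁿ → ℝᵐ be a feedback with 𝐮(x) ∈ U for all x ∈ X. Suppose B : ℝⁿ → ℝ is differentiable and satisfies: (i) B(x) ≤ 0 for all x ∈ X₀; (ii) B(x) > 0 for all x ∈ X₁; (iii) for every x ∈ X and every d ∈ D, (DB)(x)(μ(x) + d + g(x)(𝐮(x))) ≤ 0. Suppose the true drift f : ℝⁿ → ℝⁿ satisfies f(x) − μ(x) ∈ D for all x ∈ X. If φ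 : ℝ → ℝⁿ is differentiable on [0,∞) with φ(0) ∈ X₀, φ(t) ∈ X for all t ≥ 0, and φ'(t) = f(φ(t)) + g(φ(t))(𝐮(φ(t))) for all t ≥ 0, then φ(t) ∉ X₁ for all t ≥ 0. -/
open Set

/-- The pathwise content of Theorem 2 of the paper: on the event that the learned model
is accurate (`f x - μ x ∈ D` on `X`), a control barrier function robust to the
uncertainty set `D` certifies that closed-loop trajectories starting in `X₀` never reach
the unsafe set `X₁`. -/
theorem robust_barrier_safety {n m : ℕ} (X X₀ X₁ : Set (Fin n → ℝ))
    (hX₀ : X₀ ⊆ X) (hX₁ : X₁ ⊆ X)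
    (U : Set (Fin m → ℝ))
    (μ : (Fin n → ℝ) → (Fin n → ℝ))
    (g : (Fin n → ℝ) → ((Fin m → ℝ) →ₗ[ℝ] (Fin n → ℝ)))
    (D : Set (Fin n → ℝ))
    (ufb : (Fin n → ℝ) → (Fin m → ℝ)) (hufb : ∀ x ∈ X, ufb x ∈ U)
    (B : (Fin n → ℝ) → ℝ) (hB : Differentiable ℝ B)
    (hB0 : ∀ x ∈ X₀, B x ≤ 0)
    (hB1 : ∀ x ∈ X₁, 0 < B x)
    (hBdec : ∀ x ∈ X, ∀ d ∈ D, fderiv ℝ B x (μ x + d + g x (ufb x)) ≤ 0)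
    (f : (Fin n → ℝ) → (Fin n → ℝ))
    (hf : ∀ x ∈ X, f x - μ x ∈ D)
    (φ : ℝ → (Fin n → ℝ))
    (hφ0 : φ 0 ∈ X₀)
    (hφX : ∀ t ≥ (0:ℝ), φ t ∈ X)
    (hφ : ∀ t ≥ (0:ℝ),
      HasDerivWithinAt φ (f (φ t) + g (φ t) (ufb (φ t))) (Ici 0) t) :
    ∀ t ≥ (0:ℝ), φ t ∉ X₁ := by
  have hderiv : ∀ t ∈ Ici (0:ℝ), HasDerivWithinAt (B ∘ φ)
      (fderiv ℝ B (φ t) (f (φ t) + g (φ t) (ufb (φ t)))) (Ici 0) t := fun t ht =>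
    (hB (φ t)).hasFDerivAt.comp_hasDerivWithinAt t (hφ t ht)
  have hanti : AntitoneOn (B ∘ φ) (Ici 0) := by
    refine antitoneOn_of_hasDerivWithinAt_nonpos (convex_Ici 0)
      (fun t ht => (hderiv t ht).continuousWithinAt)
      (fun t ht => (hderiv t (interior_subset ht)).mono interior_subset) fun t ht => ?_
    have htX := hφX t (interior_subset ht)
    simpa using hBdec (φ t) htX _ (hf (φ t) htX)
  intro t ht hmem
  have hle : B (φ t) ≤ B (φ 0) := hanti self_mem_Ici ht ht
  exact (hB1 _ hmem).not_ge (hle.trans (hB0 _ hφ0))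
end

section
/- Let (Ω, 𝓕, ℙ) be a probability space, let X ⊆ ℝⁿ, X₀ ⊆ X, X₁ ⊆ X, U ⊆ ℝᵐ, let μ : ℝⁿ → ℝⁿ, g : ℝⁿ → (ℝᵐ →ₗ ℝⁿ), D ⊆ ℝⁿ, and let 𝐮 : ℝⁿ → ℝᵐ with 𝐮(x) ∈ U for all x ∈ X. Let f : Ω → (ℝⁿ → ℝⁿ) be a random drift and φ : Ω → (ℝ → ℝⁿ) a random trajectory such that for every ω ∈ Ω: φ(ω) is differentiable on [0,∞), φ(ω)(0) ∈ X₀, φ(ω)(t) ∈ X for all t ≥ 0, and φ(ω)'(t) = f(ω)(φ(ω)(t)) + g(φ(ω)(t))(𝐮(φ(ω)(t))) for all t ≥ 0. Suppose B : ℝⁿ → ℝ is differentiable with B ≤ 0 on X₀, B > 0 on X₁, and (DB)(x)(μ(x) + d + g(x)(𝐮(x))) ≤ 0 for all x ∈ X and all d ∈ D. Let ε ∈ (0,1) and suppose the accuracy event E := {ω | ∀ x ∈ X, f(ω)(x) − μ(x) ∈ D} is measurable with ℙ(E) ≥ (1−ε)ⁿ, and the safety event S := {ω | ∀ t ≥ 0,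 φ(ω)(t) ∉ X₁} is measurable. Then ℙ(S) ≥ (1−ε)ⁿ. -/
open Set MeasureTheory

/-- A differentiable function whose derivative along a trajectory is nonpositive is antitone
along that trajectory. -/
theorem antitoneOn_comp_of_fderiv_nonpos {E : Type*} [NormedAddCommGroup E] [NormedSpace ℝ E]
    {B : E → ℝ} (hB : Differentiable ℝ B) {γ v : ℝ → E}
    (hγ : ∀ t ≥ (0 : ℝ), HasDerivWithinAt γ (v t) (Ici 0) t)
    (hv : ∀ t ≥ (0 : ℝ), fderiv ℝ B (γ t) (v t) ≤ 0) :
    AntitoneOn (B ∘ γ) (Ici 0) := by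
  have hd : ∀ t ≥ (0 : ℝ), HasDerivWithinAt (B ∘ γ) (fderiv ℝ B (γ t) (v t)) (Ici 0) t :=
    fun t ht => (hB (γ t)).hasFDerivAt.comp_hasDerivWithinAt t (hγ t ht)
  refine antitoneOn_of_hasDerivWithinAt_nonpos (convex_Ici 0)
    (fun t ht => (hd t ht).continuousWithinAt)
    (fun t ht => (hd t (interior_subset ht)).mono interior_subset)
    (fun t ht => hv t (interior_subset ht))

/-- The probabilistic guarantee of Theorem 2 of the paper: if the accuracy event
(`f(ω)` lies in the uncertainty tube around `μ` on `X`) has probability at least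
`(1-ε)ⁿ`, and every realization of the closed-loop trajectory satisfies the dynamics
with the random drift, then the safety event (`φ(ω)` never enters `X₁`) has probability
at least `(1-ε)ⁿ`. -/
theorem probabilistic_barrier_safety {n m : ℕ} {Ω : Type*} [MeasurableSpace Ω]
    (P : Measure Ω) [IsProbabilityMeasure P]
    (X X₀ X₁ : Set (Fin n → ℝ)) (hX₀ : X₀ ⊆ X) (hX₁ : X₁ ⊆ X)
    (U : Set (Fin m → ℝ))
    (μ : (Fin n → ℝ) → (Fin n → ℝ))
    (g : (Fin n → ℝ) → ((Fin m → ℝ) →ₗ[ℝ] (Fin n → ℝ)))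
    (D : Set (Fin n → ℝ))
    (ufb : (Fin n → ℝ) → (Fin m → ℝ)) (hufb : ∀ x ∈ X, ufb x ∈ U)
    (f : Ω → (Fin n → ℝ) → (Fin n → ℝ))
    (φ : Ω → ℝ → (Fin n → ℝ))
    (hφ0 : ∀ ω, φ ω 0 ∈ X₀)
    (hφX : ∀ ω, ∀ t ≥ (0:ℝ), φ ω t ∈ X)
    (hφ : ∀ ω, ∀ t ≥ (0:ℝ),
      HasDerivWithinAt (φ ω) (f ω (φ ω t) + g (φ ω t) (ufb (φ ω t))) (Ici 0) t)
    (B : (Fin n → ℝ) → ℝ) (hB : Differentiable ℝ B)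
    (hB0 : ∀ x ∈ X₀, B x ≤ 0)
    (hB1 : ∀ x ∈ X₁, 0 < B x)
    (hBdec : ∀ x ∈ X, ∀ d ∈ D, fderiv ℝ B x (μ x + d + g x (ufb x)) ≤ 0)
    (ε : ℝ) (hε : ε ∈ Ioo (0:ℝ) 1)
    (hEmeas : MeasurableSet {ω | ∀ x ∈ X, f ω x - μ x ∈ D})
    (hEprob : ENNReal.ofReal ((1 - ε) ^ n) ≤ P {ω | ∀ x ∈ X, f ω x - μ x ∈ D})
    (hSmeas : MeasurableSet {ω | ∀ t ≥ (0:ℝ), φ ω t ∉ X₁}) :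
    ENNReal.ofReal ((1 - ε) ^ n) ≤ P {ω | ∀ t ≥ (0:ℝ), φ ω t ∉ X₁} := by
  refine hEprob.trans (measure_mono fun ω hω t ht hmem => ?_)
  have hanti : AntitoneOn (B ∘ φ ω) (Ici 0) :=
    antitoneOn_comp_of_fderiv_nonpos hB (hφ ω) fun s hs => by
      simpa using hBdec _ (hφX ω s hs) _ (hω _ (hφX ω s hs))
  have hle : B (φ ω t) ≤ B (φ ω 0) := hanti self_mem_Ici ht ht
  exact (hB1 _ hmem).not_ge (hle.trans (hB0 _ (hφ0 ω)))
end
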